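/- The logic ITL^CD is sound for the class of dynamic posets: if ITL^CD ⊢ φ, then for every dynamic poset (X,≼,S) and every valuation ⟦·⟧ on it (with respect to the up-set topology of ≼), ⟦φ⟧ = X. -/

import Mathlib

/-- Formulas of the language `L` of intuitionistic linear temporal logic. -/
inductive Formula : Type
  | bot : Formula
  | var : ℕ → Formula
  | and : Formula → Formula → Formula
  | or : Formula → Formula → Formula
  | impl : Formula → Formula → Formula
  | next : Formula → Formula
  | diam : Formula → Formula
  | box : Formula → Formula
deriving DecidableEq

namespace Formula

/-- `¬φ` abbreviates `φ → ⊥`. -/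
def neg (φ : Formula) : Formula := impl φ bot

/-- `φ ↔ ψ` abbreviates `(φ → ψ) ∧ (ψ → φ)`. -/
def iff (φ ψ : Formula) : Formula := and (impl φ ψ) (impl ψ φ)

end Formula

/-- Derivability in `ITL⁰` extended with an additional set of axioms `Ax`.
The intuitionistic propositional tautologies are generated by a standard
complete Hilbert-style axiomatization of intuitionistic propositional logic
(closed under modus ponens). -/
inductive ITL (Ax : Formula → Prop) : Formula → Prop
  | extra {φ} : Ax φ → ITL Ax φ
  -- (i) intuitionistic propositional axioms
  | then1 (φ ψ : Formula) : ITL Ax (.impl φ (.impl ψ φ))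
  | then2 (φ ψ χ : Formula) :
      ITL Ax (.impl (.impl φ (.impl ψ χ)) (.impl (.impl φ ψ) (.impl φ χ)))
  | andE1 (φ ψ : Formula) : ITL Ax (.impl (.and φ ψ) φ)
  | andE2 (φ ψ : Formula) : ITL Ax (.impl (.and φ ψ) ψ)
  | andI (φ ψ : Formula) : ITL Ax (.impl φ (.impl ψ (.and φ ψ)))
  | orI1 (φ ψ : Formula) : ITL Ax (.impl φ (.or φ ψ))
  | orI2 (φ ψ : Formula) : ITL Ax (.impl ψ (.or φ ψ))
  | orE (φ ψ χ : Formula) :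
      ITL Ax (.impl (.impl φ χ) (.impl (.impl ψ χ) (.impl (.or φ ψ) χ)))
  | botE (φ : Formula) : ITL Ax (.impl .bot φ)
  -- (ii)–(x) temporal axioms
  | nextBot : ITL Ax (.neg (.next .bot))
  | nextAnd (φ ψ : Formula) :
      ITL Ax (.iff (.next (.and φ ψ)) (.and (.next φ) (.next ψ)))
  | nextOr (φ ψ : Formula) :
      ITL Ax (.iff (.next (.or φ ψ)) (.or (.next φ) (.next ψ)))
  | nextK (φ ψ : Formula) :
      ITL Ax (.impl (.next (.impl φ ψ)) (.impl (.next φ) (.next ψ)))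
  | boxK (φ ψ : Formula) :
      ITL Ax (.impl (.box (.impl φ ψ)) (.impl (.box φ) (.box ψ)))
  | diamK (φ ψ : Formula) :
      ITL Ax (.impl (.box (.impl φ ψ)) (.impl (.diam φ) (.diam ψ)))
  | diamOr (φ ψ : Formula) :
      ITL Ax (.impl (.diam (.or φ ψ)) (.or (.diam φ) (.diam ψ)))
  | boxFix (φ : Formula) : ITL Ax (.impl (.box φ) (.and φ (.next (.box φ))))
  | diamFix (φ : Formula) : ITL Ax (.impl (.or φ (.next (.diam φ))) (.diam φ))
  -- rules (xi)–(xiv)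
  | ind1 {φ : Formula} : ITL Ax (.impl φ (.next φ)) → ITL Ax (.impl φ (.box φ))
  | ind2 {φ : Formula} : ITL Ax (.impl (.next φ) φ) → ITL Ax (.impl (.diam φ) φ)
  | mp {φ ψ : Formula} : ITL Ax (.impl φ ψ) → ITL Ax φ → ITL Ax ψ
  | nec {φ : Formula} : ITL Ax φ → ITL Ax (.next φ)

/-- The Fischer Servi axiom schemes FS◦ and FS◇. -/
def FSAx : Formula → Prop := fun χ => ∃ φ ψ : Formula,
  χ = .impl (.impl (.next φ) (.next ψ)) (.next (.impl φ ψ)) ∨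
  χ = .impl (.impl (.diam φ) (.box ψ)) (.box (.impl φ ψ))

/-- The constant domain axiom scheme CD. -/
def CDAx : Formula → Prop := fun χ => ∃ φ ψ : Formula,
  χ = .impl (.box (.or φ ψ)) (.or (.box φ) (.diam ψ))

/-- The logic ITL⁰. -/
def ITL0 : Formula → Prop := ITL (fun _ => False)

/-- The logic ITL^FS = ITL⁰ + FS◦ + FS◇. -/
def ITLFS : Formula → Prop := ITL FSAx

/-- The logic ITL^CD = ITL⁰ + CD. -/
def ITLCD : Formula → Prop := ITL CDAx

/-- The logic ITL¹ = ITL^FS + ITL^CD. -/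
def ITL1 : Formula → Prop := ITL (fun χ => FSAx χ ∨ CDAx χ)

/-- A valuation on a dynamical topological system `(X, T, S)`: a map from
formulas to open sets satisfying the semantic clauses. -/
structure DTValuation (X : Type) (T : TopologicalSpace X) (S : X → X) where
  val : Formula → Set X
  isOpen_val : ∀ φ, @IsOpen X T (val φ)
  val_bot : val .bot = ∅
  val_and : ∀ φ ψ, val (.and φ ψ) = val φ ∩ val ψ
  val_or : ∀ φ ψ, val (.or φ ψ) = val φ ∪ val ψ
  val_impl : ∀ φ ψ, val (.impl φ ψ) = @interior X T ((val φ)ᶜ ∪ val ψ)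
  val_next : ∀ φ, val (.next φ) = S ⁻¹' val φ
  val_diam : ∀ φ, val (.diam φ) = ⋃ n : ℕ, (S^[n]) ⁻¹' val φ
  val_box : ∀ φ, val (.box φ) =
    ⋃₀ {U : Set X | @IsOpen X T U ∧ S '' U ⊆ U ∧ U ⊆ val φ}

/-- The up-set topology of a preorder: the open sets are the upward closed sets. -/
def upsetTopology (X : Type) [Preorder X] : TopologicalSpace X where
  IsOpen U := IsUpperSet U
  isOpen_univ := isUpperSet_univ
  isOpen_inter := fun _ _ hU hV => hU.inter hV
  isOpen_sUnion := fun _ hs => isUpperSet_sUnion hs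

section UpsetSemantics

variable {X : Type} [Preorder X] {S : X → X}

/-- A map that is continuous for the up-set topology is monotone. -/
theorem monotone_of_continuous_upsetTopology
    (hS : @Continuous X X (upsetTopology X) (upsetTopology X) S) : Monotone S := by
  intro x y hxy
  have hopen : IsUpperSet (S ⁻¹' Set.Ici (S x)) :=
    (@Continuous.isOpen_preimage X X (upsetTopology X) (upsetTopology X) S hS) _
      (isUpperSet_Ici (S x))
  exact hopen hxy (Set.mem_Ici.2 le_rfl)

/-- The interior in the up-set topology is the largest up-set contained in the set. -/
theorem mem_interior_upsetTopology {s : Set X} {x : X} :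
    x ∈ @interior X (upsetTopology X) s ↔ ∀ y, x ≤ y → y ∈ s := by
  constructor
  · rintro ⟨U, ⟨hU, hUs⟩, hx⟩ y hxy
    exact hUs ((show IsUpperSet U from hU) hxy hx)
  · exact fun h => ⟨Set.Ici x, ⟨isUpperSet_Ici x, h⟩, Set.mem_Ici.2 le_rfl⟩

namespace DTValuation

variable (V : DTValuation X (upsetTopology X) S) {φ ψ : Formula} {x : X}

theorem mem_bot : x ∈ V.val .bot ↔ False := by
  rw [V.val_bot, Set.mem_empty_iff_false]

theorem mem_and : x ∈ V.val (.and φ ψ) ↔ x ∈ V.val φ ∧ x ∈ V.val ψ := by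
  rw [V.val_and, Set.mem_inter_iff]

theorem mem_or : x ∈ V.val (.or φ ψ) ↔ x ∈ V.val φ ∨ x ∈ V.val ψ := by
  rw [V.val_or, Set.mem_union]

theorem mem_impl : x ∈ V.val (.impl φ ψ) ↔ ∀ y, x ≤ y → y ∈ V.val φ → y ∈ V.val ψ := by
  rw [V.val_impl, mem_interior_upsetTopology]
  simp only [Set.mem_union, Set.mem_compl_iff, imp_iff_not_or]

theorem mem_next : x ∈ V.val (.next φ) ↔ S x ∈ V.val φ := by
  rw [V.val_next, Set.mem_preimage]

theorem mem_diam : x ∈ V.val (.diam φ) ↔ ∃ n, S^[n] x ∈ V.val φ := by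
  rw [V.val_diam, Set.mem_iUnion]
  rfl

theorem mem_of_le {y : X} (hxy : x ≤ y) (hx : x ∈ V.val φ) : y ∈ V.val φ :=
  (show IsUpperSet (V.val φ) from V.isOpen_val φ) hxy hx

/-- On a dynamic poset, `□` quantifies over the orbit of a point. -/
theorem mem_box (hS : Monotone S) : x ∈ V.val (.box φ) ↔ ∀ n, S^[n] x ∈ V.val φ := by
  rw [V.val_box]
  constructor
  · rintro ⟨U, ⟨-, hSU, hUφ⟩, hx⟩ n
    exact hUφ ((Set.mapsTo_iff_image_subset.2 hSU).iterate n hx)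
  · refine fun h => ⟨{y | ∀ n, S^[n] y ∈ V.val φ}, ⟨?_, ?_, fun y hy => hy 0⟩, h⟩
    · exact fun y z hyz hy n => V.mem_of_le (hS.iterate n hyz) (hy n)
    · rintro _ ⟨y, hy, rfl⟩ n
      exact hy (n + 1)

/-- Every theorem of `ITL^CD` holds at every point. -/
theorem mem_of_itlcd (hS : Monotone S) (h : ITLCD φ) (x : X) : x ∈ V.val φ := by
  have up {χ : Formula} {y z : X} : y ≤ z → y ∈ V.val χ → z ∈ V.val χ := V.mem_of_le
  induction h generalizing x with
  | extra hax =>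
    obtain ⟨φ, ψ, rfl⟩ := hax
    simp only [mem_impl, mem_or, mem_diam, V.mem_box hS]
    intro y _ hy
    by_cases hψ : ∃ n, S^[n] y ∈ V.val ψ
    · exact Or.inr hψ
    · exact Or.inl fun n => (hy n).resolve_right fun hn => hψ ⟨n, hn⟩
  | then1 =>
    simp only [mem_impl]
    exact fun y _ hy z hyz _ => up hyz hy
  | then2 =>
    simp only [mem_impl]
    exact fun y _ h₁ z hyz h₂ w hzw hw =>
      h₁ w (hyz.trans hzw) hw w le_rfl (h₂ w hzw hw)
  | andE1 =>
    simp only [mem_impl, mem_and]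
    exact fun y _ hy => hy.1
  | andE2 =>
    simp only [mem_impl, mem_and]
    exact fun y _ hy => hy.2
  | andI =>
    simp only [mem_impl, mem_and]
    exact fun y _ hy z hyz hz => ⟨up hyz hy, hz⟩
  | orI1 =>
    simp only [mem_impl, mem_or]
    exact fun y _ hy => Or.inl hy
  | orI2 =>
    simp only [mem_impl, mem_or]
    exact fun y _ hy => Or.inr hy
  | orE =>
    simp only [mem_impl, mem_or]
    exact fun y _ h₁ z hyz h₂ w hzw hw =>
      hw.elim (h₁ w (hyz.trans hzw)) (h₂ w hzw)
  | botE =>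
    simp only [mem_impl, mem_bot]
    exact fun y _ hy => hy.elim
  | nextBot => simp [Formula.neg, mem_impl, mem_next, mem_bot]
  | nextAnd => simp [Formula.iff, mem_impl, mem_and, mem_next]
  | nextOr => simp [Formula.iff, mem_impl, mem_and, mem_or, mem_next]
  | nextK =>
    simp only [mem_impl, mem_next]
    exact fun y _ h₁ z hyz hz => h₁ (S z) (hS hyz) hz
  | boxK =>
    simp only [mem_impl, V.mem_box hS]
    exact fun y _ h₁ z hyz hz n => h₁ n _ (hS.iterate n hyz) (hz n)
  | diamK =>
    simp only [mem_impl, V.mem_box hS, mem_diam]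
    exact fun y _ h₁ z hyz ⟨n, hn⟩ => ⟨n, h₁ n _ (hS.iterate n hyz) hn⟩
  | diamOr =>
    simp only [mem_impl, mem_or, mem_diam, exists_or]
    exact fun y _ hy => hy
  | boxFix =>
    simp only [mem_impl, mem_and, mem_next, V.mem_box hS]
    exact fun y _ hy => ⟨hy 0, fun n => hy (n + 1)⟩
  | diamFix =>
    simp only [mem_impl, mem_or, mem_next, mem_diam]
    rintro y - (hy | ⟨n, hn⟩)
    exacts [⟨0, hy⟩, ⟨n + 1, hn⟩]
  | ind1 _ ih =>
    simp only [mem_impl, mem_next, V.mem_box hS] at ih ⊢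
    rintro y - hy n
    induction n generalizing y with
    | zero => exact hy
    | succ n hn => exact hn (S y) (ih y y le_rfl hy)
  | ind2 _ ih =>
    simp only [mem_impl, mem_next, mem_diam] at ih ⊢
    rintro y - ⟨n, hn⟩
    induction n generalizing y with
    | zero => exact hn
    | succ n hind => exact ih y y le_rfl (hind (S y) hn)
  | mp _ _ ih₁ ih₂ => exact V.mem_impl.1 (ih₁ x) x le_rfl (ih₂ x)
  | nec _ ih => exact V.mem_next.2 (ih (S x))

end DTValuation

end UpsetSemantics

/-- Theorem 2: soundness of ITL^CD for the class of dynamic posets. -/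
theorem itlcd_sound (φ : Formula) (h : ITLCD φ)
    (X : Type) [PartialOrder X] (S : X → X)
    (hS : @Continuous X X (upsetTopology X) (upsetTopology X) S)
    (V : DTValuation X (upsetTopology X) S) : V.val φ = Set.univ := by
  exact Set.eq_univ_of_forall
    (V.mem_of_itlcd (monotone_of_continuous_upsetTopology hS) h)
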